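/- Let 2 ≤ k ≤ n. There exists a constant C > 0 depending only on n and k such that for every λ ∈ Γ_k one has ((n − k + 1)/k) · σ_k(λ)^{(1-k)/k} · σ_{k-1}(λ) ≥ (1/C) · max{ 1, σ₁(λ)^{1/(k-1)} · σ_k(λ)^{-1/(k(k-1))} }. -/

import Mathlib

/-- The `m`-th elementary symmetric polynomial of `λ ∈ ℝⁿ`. -/
noncomputable def esymm (n m : ℕ) (lam : Fin n → ℝ) : ℝ :=
  ∑ s ∈ Finset.powersetCard m (Finset.univ : Finset (Fin n)), ∏ i ∈ s, lam i

/-- The Gårding cone `Γ_k`. -/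
def GardingCone (n k : ℕ) : Set (Fin n → ℝ) :=
  {lam | ∀ j, 1 ≤ j → j ≤ k → 0 < esymm n j lam}

open Polynomial in
/-- By Rolle's theorem, the derivative of a real-rooted polynomial is real-rooted. -/
theorem splits_derivative_of_splits {p : ℝ[X]} (hp : p.Splits) : (derivative p).Splits := by
  rw [splits_iff_card_roots]
  have h1 := card_roots_le_derivative p
  have h2 := card_roots' (derivative p)
  have h3 := natDegree_derivative_le p
  have h4 := hp.natDegree_eq_card_roots
  omega

open Polynomial in
/-- The case of lowest-order coefficients in Newton's inequalities for a real-rooted polynomial. -/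
theorem two_mul_coeff_zero_mul_coeff_two_le {p : ℝ[X]} (hp : p.Splits) :
    2 * (p.coeff 0 * p.coeff 2) ≤ p.coeff 1 ^ 2 := by
  induction hp using Submonoid.closure_induction_left with
  | one => simp [coeff_one]
  | mul_left x hx q _ ih =>
    rcases hx with ⟨a, rfl⟩ | ⟨a, rfl⟩
    · simp only [coeff_C_mul]
      nlinarith [mul_le_mul_of_nonneg_left ih (sq_nonneg a)]
    · have h0 : ((X + C a) * q).coeff 0 = a * q.coeff 0 := by simp [add_mul]
      have h1 : ((X + C a) * q).coeff 1 = q.coeff 0 + a * q.coeff 1 := by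
        simp [add_mul, coeff_X_mul]
      have h2 : ((X + C a) * q).coeff 2 = q.coeff 1 + a * q.coeff 2 := by
        simp [add_mul, coeff_X_mul]
      rw [h0, h1, h2]
      nlinarith [mul_le_mul_of_nonneg_left ih (sq_nonneg a), sq_nonneg (q.coeff 0)]

open Polynomial in
/-- Newton's inequalities for the coefficients of a real-rooted polynomial. -/
theorem newton_coeff_inequality (j : ℕ) {p : ℝ[X]} (hp : p.Splits) :
    ((j : ℝ) + 2) * (p.coeff j * p.coeff (j + 2)) ≤ ((j : ℝ) + 1) * p.coeff (j + 1) ^ 2 := by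
  induction j generalizing p with
  | zero => simpa using two_mul_coeff_zero_mul_coeff_two_le hp
  | succ j ih =>
    have h := ih (splits_derivative_of_splits hp)
    simp only [coeff_derivative] at h
    push_cast at h ⊢
    have hpos : (0 : ℝ) < ((j : ℝ) + 1) * (j + 2) := by positivity
    refine le_of_mul_le_mul_left ?_ hpos
    have e : j + 2 + 1 = j + 1 + 2 := by ring
    rw [e] at h
    linear_combination h

open Polynomial in
/-- Log-concavity of the elementary symmetric polynomials at a real point. -/
theorem esymm_mul_esymm_le_sq (n m : ℕ) (hm : m + 2 ≤ n) (lam : Fin n → ℝ)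
    (h0 : 0 ≤ esymm n m lam * esymm n (m + 2) lam) :
    esymm n m lam * esymm n (m + 2) lam ≤ esymm n (m + 1) lam ^ 2 := by
  obtain ⟨j, rfl⟩ := Nat.exists_eq_add_of_le hm
  have hcoeff : ∀ i ≤ m + 2 + j, (∏ i, (X + C (lam i))).coeff i =
      esymm (m + 2 + j) (m + 2 + j - i) lam := by
    intro i hi
    rw [Finset.prod_X_add_C_coeff _ _ (by simpa using hi)]
    simp [esymm]
  have h := newton_coeff_inequality j
    (Splits.prod (s := Finset.univ) fun i _ => Splits.X_add_C (lam i))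
  rw [hcoeff _ (by omega), hcoeff _ (by omega), hcoeff _ (by omega),
    show m + 2 + j - j = m + 2 by omega, show m + 2 + j - (j + 2) = m by omega,
    show m + 2 + j - (j + 1) = m + 1 by omega] at h
  have hj : (0 : ℝ) < (j : ℝ) + 1 := by positivity
  refine le_of_mul_le_mul_left ?_ hj
  linarith

/-- The last ratio of a positive log-concave sequence bounds all growth rates from below. -/
theorem ratio_pow_mul_le_of_logConcave {s : ℕ → ℝ} {k : ℕ}
    (hpos : ∀ j ≤ k + 1, 0 < s j) (hlc : ∀ j < k, s j * s (j + 2) ≤ s (j + 1) ^ 2)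
    {i m : ℕ} (him : m + i ≤ k) : (s (k + 1) / s k) ^ i * s m ≤ s (m + i) := by
  have hr : 0 < s (k + 1) / s k := div_pos (hpos _ le_rfl) (hpos _ (by omega))
  have hstep : ∀ j ≤ k, s (k + 1) / s k * s j ≤ s (j + 1) := by
    intro j hj
    induction hj using Nat.decreasingInduction with
    | self => rw [div_mul_cancel₀ _ (hpos k (by omega)).ne']
    | of_succ j hj ih =>
      have h1 := hpos (j + 1) (by omega)
      have h2 := hpos j (by omega)
      refine le_of_mul_le_mul_right ?_ h1
      calc s (k + 1) / s k * s j * s (j + 1) = s j * (s (k + 1) / s k * s (j + 1)) := by ring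
        _ ≤ s j * s (j + 2) := mul_le_mul_of_nonneg_left ih h2.le
        _ ≤ s (j + 1) ^ 2 := hlc j hj
        _ = s (j + 1) * s (j + 1) := sq _
  induction i with
  | zero => simp
  | succ i ih =>
    calc (s (k + 1) / s k) ^ (i + 1) * s m
        = s (k + 1) / s k * ((s (k + 1) / s k) ^ i * s m) := by ring
      _ ≤ s (k + 1) / s k * s (m + i) := mul_le_mul_of_nonneg_left (ih (by omega)) hr.le
      _ ≤ s (m + (i + 1)) := hstep _ (by omega)

/-- for `2 ≤ k ≤ n` there exists `C > 0` depending only on `n, k` such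
that for every `λ ∈ Γ_k`,
`((n-k+1)/k) σ_k(λ)^{(1-k)/k} σ_{k-1}(λ) ≥ (1/C) max{1, σ₁(λ)^{1/(k-1)} σ_k(λ)^{-1/(k(k-1))}}`. -/
theorem stmt10 (n k : ℕ) (hk : 2 ≤ k) (hkn : k ≤ n) :
    ∃ C : ℝ, 0 < C ∧ ∀ lam ∈ GardingCone n k,
      (((n : ℝ) - k + 1) / k) * (esymm n k lam) ^ ((1 - (k : ℝ)) / k) * esymm n (k - 1) lam ≥
        (1 / C) * max 1
          ((esymm n 1 lam) ^ ((1 : ℝ) / ((k : ℝ) - 1)) *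
            (esymm n k lam) ^ (-(1 : ℝ) / ((k : ℝ) * ((k : ℝ) - 1)))) := by
  obtain ⟨l, rfl⟩ := Nat.exists_eq_add_of_le' hk
  refine ⟨((l + 2 : ℕ) : ℝ), by positivity, fun lam hlam => ?_⟩
  have hpos : ∀ j ≤ l + 1 + 1, 0 < esymm n j lam := by
    intro j hj
    rcases Nat.eq_zero_or_pos j with rfl | h
    · simp [esymm]
    · exact hlam j h hj
  have hlc : ∀ j < l + 1,
      esymm n j lam * esymm n (j + 2) lam ≤ esymm n (j + 1) lam ^ 2 := fun j hj =>
    esymm_mul_esymm_le_sq n j (by omega) lam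
      (mul_pos (hpos _ (by omega)) (hpos _ (by omega))).le
  have hA := ratio_pow_mul_le_of_logConcave (s := fun j => esymm n j lam) hpos hlc
    (i := l + 1) (m := 0) (by omega)
  have hB := ratio_pow_mul_le_of_logConcave (s := fun j => esymm n j lam) hpos hlc
    (i := l) (m := 1) (by omega)
  have hzero : esymm n 0 lam = 1 := by simp [esymm]
  simp only [zero_add, hzero, mul_one, add_comm 1 l] at hA hB
  rw [show l + 2 - 1 = l + 1 from rfl]
  rw [show l + 1 + 1 = l + 2 from rfl] at hA hB
  have p1 := hpos 1 (by omega)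
  have pb := hpos (l + 1) (by omega)
  have pc := hpos (l + 2) (by omega)
  generalize esymm n 1 lam = s at *
  generalize esymm n (l + 1) lam = t at *
  generalize esymm n (l + 2) lam = u at *
  have hA' := Real.log_le_log (by positivity) hA
  have hB' := Real.log_le_log (by positivity) hB
  rw [Real.log_pow, Real.log_div pc.ne' pb.ne'] at hA'
  rw [Real.log_mul (by positivity) p1.ne', Real.log_pow, Real.log_div pc.ne' pb.ne'] at hB'
  push_cast at hA' hB' ⊢
  have hl : (0 : ℝ) ≤ l := Nat.cast_nonneg l
  have hmain : max 1 (s ^ ((1 : ℝ) / ((l : ℝ) + 2 - 1)) *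
      u ^ (-(1 : ℝ) / (((l : ℝ) + 2) * ((l : ℝ) + 2 - 1)))) ≤
      u ^ ((1 - ((l : ℝ) + 2)) / (l + 2)) * t := by
    have hl1 : (l : ℝ) + 2 - 1 = l + 1 := by ring
    rw [hl1, show 1 - ((l : ℝ) + 2) = -(l + 1) by ring]
    rw [Real.rpow_def_of_pos pc, Real.rpow_def_of_pos p1, Real.rpow_def_of_pos pc,
      ← Real.exp_add]
    nth_rewrite 1 [← Real.exp_log pb]
    rw [← Real.exp_add]
    refine max_le (Real.one_le_exp ?_) (Real.exp_le_exp.2 ?_)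
    · have e : Real.log u * (-((l : ℝ) + 1) / (l + 2)) + Real.log t =
          (((l : ℝ) + 2) * Real.log t - (l + 1) * Real.log u) / (l + 2) := by
        field_simp
        ring
      rw [e]
      exact div_nonneg (by linarith) (by positivity)
    · have e : Real.log u * (-((l : ℝ) + 1) / (l + 2)) + Real.log t -
          (Real.log s * (1 / (l + 1)) + Real.log u * (-1 / ((l + 2) * (l + 1)))) =
          (((l : ℝ) + 1) * Real.log t - l * Real.log u - Real.log s) / (l + 1) := by
        field_simp
        ring
      rw [← sub_nonneg, e]
      exact div_nonneg (by linarith) (by positivity)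
  have hn : ((l : ℝ) + 2) ≤ n := by exact_mod_cast hkn
  rw [ge_iff_le, mul_assoc]
  refine mul_le_mul ?_ hmain (by positivity) (div_nonneg (by linarith) (by linarith))
  gcongr
  linarith
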